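/- Let 0 < r < R and A = { x ∈ B_R : ‖x‖ > r }. There exists a constant c > 0 such that for every μ ≥ 1 the following holds: if ϖ is a smooth nonnegative function on closure(B_R), vanishing on ∂B_R, with ∫_{B_R} ϖ² = 1, satisfying −Δϖ + μ²‖x‖² ϖ = ν_μ ϖ in B_R, where ν_μ = inf { R_μ(w) : w ∈ C_c^∞(B_R), w ≠ 0 } is the smallest Dirichlet eigenvalue of −Δ + μ²‖x‖² on B_R, then ∫_A ϖ² ≤ c ( μ^{d/2 − 1} e^{−μ r²} + μ^{2 + d/2} e^{−μ R²} ). -/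

import Mathlib

open MeasureTheory Metric Set Filter

/-- The Rayleigh quotient of the operator `−Δ + μ²‖x‖²` on the ball `B_R`. -/
noncomputable def rayleigh (n : ℕ) (R μ : ℝ) (w : EuclideanSpace ℝ (Fin n) → ℝ) : ℝ :=
  (∫ x in ball (0 : EuclideanSpace ℝ (Fin n)) R,
      (‖gradient w x‖ ^ 2 + μ ^ 2 * ‖x‖ ^ 2 * (w x) ^ 2)) /
  (∫ x in ball (0 : EuclideanSpace ℝ (Fin n)) R, (w x) ^ 2)

/-- The bottom `ν_μ` of the Rayleigh quotient (the smallest Dirichlet eigenvalue of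
`−Δ + μ²‖x‖²` on `B_R`). -/
noncomputable def nuBottom (n : ℕ) (R μ : ℝ) : ℝ :=
  sInf {ν : ℝ | ∃ w : EuclideanSpace ℝ (Fin n) → ℝ,
    ContDiff ℝ (⊤ : ℕ∞) w ∧ HasCompactSupport w ∧
    tsupport w ⊆ ball (0 : EuclideanSpace ℝ (Fin n)) R ∧ w ≠ 0 ∧ ν = rayleigh n R μ w}

/-- The Euclidean Laplacian of `f : ℝ^n → ℝ` at `x`. -/
noncomputable def lapl {n : ℕ} (f : EuclideanSpace ℝ (Fin n) → ℝ)
    (x : EuclideanSpace ℝ (Fin n)) : ℝ :=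
  ∑ i, fderiv ℝ (fun z => fderiv ℝ f z (EuclideanSpace.single i 1)) x (EuclideanSpace.single i 1)

/-- A function which is Lipschitz on a closed ball and vanishes on its boundary sphere stays Lipschitz
when extended by zero. -/
theorem LipschitzOnWith.indicator_closedBall {E : Type*} [NormedAddCommGroup E] [NormedSpace ℝ E]
    {R : ℝ} {C : NNReal} {F : E → ℝ} (hF : LipschitzOnWith C F (closedBall 0 R))
    (hF0 : ∀ x ∈ sphere (0 : E) R, F x = 0) :
    LipschitzWith C ((closedBall (0 : E) R).indicator F) := by
  have cross : ∀ x ∈ closedBall (0 : E) R, ∀ y ∉ closedBall (0 : E) R, |F x| ≤ C * dist x y := by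
    intro x hx y hy
    rw [mem_closedBall_zero_iff] at hx hy
    push Not at hy
    have hc : ContinuousOn (fun t : ℝ => ‖AffineMap.lineMap x y t‖) (Icc (0 : ℝ) 1) := by
      refine Continuous.continuousOn ?_
      exact AffineMap.lineMap_continuous.norm
    obtain ⟨t, ht, htR⟩ := intermediate_value_Icc zero_le_one hc
      (show R ∈ Icc _ _ by simpa using ⟨hx, hy.le⟩)
    have hz : AffineMap.lineMap x y t ∈ sphere (0 : E) R := by
      rw [mem_sphere_zero_iff_norm]; exact htR
    have h1 := hF.dist_le_mul x (by simpa using hx) _ (sphere_subset_closedBall hz)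
    rw [hF0 _ hz, Real.dist_0_eq_abs, dist_left_lineMap, Real.norm_of_nonneg ht.1] at h1
    refine h1.trans ?_
    gcongr
    exact mul_le_of_le_one_left dist_nonneg ht.2
  refine LipschitzWith.of_dist_le_mul fun x y => ?_
  by_cases hx : x ∈ closedBall (0 : E) R <;> by_cases hy : y ∈ closedBall (0 : E) R
  · simpa only [indicator_of_mem hx, indicator_of_mem hy] using hF.dist_le_mul x hx y hy
  · simpa only [indicator_of_mem hx, indicator_of_notMem hy, Real.dist_0_eq_abs]
      using cross x hx y hy
  · rw [dist_comm, dist_comm x]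
    simpa only [indicator_of_mem hy, indicator_of_notMem hx, Real.dist_0_eq_abs]
      using cross y hy x hx
  · simp only [indicator_of_notMem hx, indicator_of_notMem hy, dist_self]
    positivity

theorem uniqueDiffOn_closedBall {E : Type*} [NormedAddCommGroup E] [NormedSpace ℝ E]
    {R : ℝ} (hR : 0 < R) : UniqueDiffOn ℝ (closedBall (0 : E) R) :=
  uniqueDiffOn_convex (convex_closedBall _ _)
    ⟨0, ball_subset_interior_closedBall (mem_ball_self hR)⟩

section Ball

variable {E : Type*} [NormedAddCommGroup E] [InnerProductSpace ℝ E] [FiniteDimensional ℝ E]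
  [MeasurableSpace E] [BorelSpace E]

theorem integrableOn_ball_fderiv {R : ℝ} (hR : 0 < R) {F : E → ℝ}
    (hF : ContDiffOn ℝ 1 F (closedBall 0 R)) (v : E) :
    IntegrableOn (fun x => fderiv ℝ F x v) (ball 0 R) := by
  have h1 : ContinuousOn (fun x => fderivWithin ℝ F (closedBall 0 R) x v) (closedBall 0 R) :=
    (hF.continuousOn_fderivWithin (uniqueDiffOn_closedBall hR) le_rfl).clm_apply
      continuousOn_const
  refine ((h1.integrableOn_compact (isCompact_closedBall _ _)).mono_set
    ball_subset_closedBall).congr_fun (fun x hx => ?_) measurableSet_ball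
  simp only [fderivWithin_of_mem_nhds
    (mem_of_superset (isOpen_ball.mem_nhds hx) ball_subset_closedBall)]

theorem integral_ball_fderiv_eq_zero {R : ℝ} (hR : 0 < R) {F : E → ℝ}
    (hF : ContDiffOn ℝ 1 F (closedBall 0 R)) (hF0 : ∀ x ∈ sphere (0 : E) R, F x = 0) (v : E) :
    ∫ x in ball 0 R, fderiv ℝ F x v = 0 := by
  have hcont := hF.continuousOn_fderivWithin (uniqueDiffOn_closedBall hR) le_rfl
  obtain ⟨C, hC⟩ := (isCompact_closedBall (0 : E) R).exists_bound_of_continuousOn hcont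
  have hL : LipschitzOnWith C.toNNReal F (closedBall 0 R) := by
    refine (convex_closedBall _ _).lipschitzOnWith_of_nnnorm_fderivWithin_le
      (hF.differentiableOn one_ne_zero) fun x hx => ?_
    rw [← NNReal.coe_le_coe, coe_nnnorm]
    exact (hC x hx).trans (Real.le_coe_toNNReal C)
  have hG := hL.indicator_closedBall hF0
  have hGc : HasCompactSupport ((closedBall (0 : E) R).indicator F) :=
    HasCompactSupport.of_support_subset_isCompact (isCompact_closedBall 0 R) support_indicator_subset
  have hconst : ∀ (c : ℝ) (x w : E), lineDeriv ℝ (fun _ => c) x w = 0 := fun c x w => by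
    simp [lineDeriv]
  have key := (LipschitzWith.const (1 : ℝ)).integral_lineDeriv_mul_eq (μ := volume) hG hGc (-v)
  simp only [hconst, zero_mul, integral_zero, neg_neg, mul_one] at key
  have : ∫ x, lineDeriv ℝ ((closedBall (0 : E) R).indicator F) x v
      = ∫ x in ball 0 R, fderiv ℝ F x v := by
    rw [← integral_indicator measurableSet_ball]
    refine integral_congr_ae ?_
    have hs : ∀ᵐ x : E, x ∉ sphere (0 : E) R :=
      measure_eq_zero_iff_ae_notMem.1 (Measure.addHaar_sphere_of_ne_zero volume 0 hR.ne')
    filter_upwards [hs] with x hx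
    by_cases hxb : x ∈ ball (0 : E) R
    · have hn := isOpen_ball.mem_nhds hxb
      rw [indicator_of_mem hxb]
      have he : (closedBall (0 : E) R).indicator F =ᶠ[nhds x] F := by
        filter_upwards [hn] with y hy using indicator_of_mem (ball_subset_closedBall hy) _
      rw [he.lineDeriv_eq]
      exact ((hF.contDiffAt (mem_of_superset hn ball_subset_closedBall)).differentiableAt
        one_ne_zero).lineDeriv_eq_fderiv
    · have hxc : x ∉ closedBall (0 : E) R := fun h => by
        rw [← ball_union_sphere] at h
        exact h.elim hxb hx
      rw [indicator_of_notMem hxb]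
      have he : (closedBall (0 : E) R).indicator F =ᶠ[nhds x] fun _ => 0 := by
        filter_upwards [isClosed_closedBall.isOpen_compl.mem_nhds hxc] with y hy
          using indicator_of_notMem hy _
      rw [he.lineDeriv_eq]
      exact hconst 0 x v
  rw [← this, ← key]

end Ball

/-- The divergence theorem on a ball for `C¹` vector fields vanishing on the boundary sphere. -/
theorem integral_ball_divergence_eq_zero {n : ℕ} {R : ℝ} (hR : 0 < R)
    {W : Fin n → EuclideanSpace ℝ (Fin n) → ℝ} {D : EuclideanSpace ℝ (Fin n) → ℝ}
    (hW : ∀ i, ContDiffOn ℝ 1 (W i) (closedBall 0 R))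
    (hW0 : ∀ i, ∀ x ∈ sphere 0 R, W i x = 0)
    (hD : ∀ x ∈ ball 0 R, ∑ i, fderiv ℝ (W i) x (EuclideanSpace.single i 1) = D x) :
    IntegrableOn D (ball 0 R) ∧ ∫ x in ball 0 R, D x = 0 := by
  have hint := fun i => integrableOn_ball_fderiv hR (hW i) (EuclideanSpace.single i 1)
  refine ⟨IntegrableOn.congr_fun (integrable_finsetSum Finset.univ fun i _ => hint i) hD
    measurableSet_ball, ?_⟩
  rw [← setIntegral_congr_fun measurableSet_ball hD, integral_finsetSum _ fun i _ => hint i]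
  exact Finset.sum_eq_zero fun i _ => integral_ball_fderiv_eq_zero hR (hW i) (hW0 i) _

/-- The kernel `K(s) = ∫₀¹ τ^(d-1) e^{a s (1-τ²)} dτ` solving `2 s K' = (2 a s - d) K + 1`. -/
noncomputable def radialKernel (d : ℕ) (a s : ℝ) : ℝ :=
  ∫ τ in (0 : ℝ)..1, τ ^ (d - 1) * Real.exp (a * s * (1 - τ ^ 2))

/-- The derivative of `radialKernel` in `s`. -/
noncomputable def radialKernelDeriv (d : ℕ) (a s : ℝ) : ℝ :=
  ∫ τ in (0 : ℝ)..1, τ ^ (d - 1) * (Real.exp (a * s * (1 - τ ^ 2)) * (a * (1 - τ ^ 2)))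

theorem hasDerivAt_radialKernel (d : ℕ) (a s : ℝ) :
    HasDerivAt (radialKernel d a) (radialKernelDeriv d a s) s := by
  have hcont : Continuous (fun q : ℝ × ℝ =>
      q.2 ^ (d - 1) * (Real.exp (a * q.1 * (1 - q.2 ^ 2)) * (a * (1 - q.2 ^ 2)))) := by fun_prop
  obtain ⟨B, hB⟩ := ((isCompact_closedBall s 1).prod (isCompact_Icc (a := (0 : ℝ)) (b := 1))
    ).exists_bound_of_continuousOn hcont.continuousOn
  refine (intervalIntegral.hasDerivAt_integral_of_dominated_loc_of_deriv_le
    (F := fun s τ => τ ^ (d - 1) * Real.exp (a * s * (1 - τ ^ 2)))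
    (F' := fun s τ => τ ^ (d - 1) * (Real.exp (a * s * (1 - τ ^ 2)) * (a * (1 - τ ^ 2))))
    (bound := fun _ => B) (ball_mem_nhds s one_pos) ?_ ?_ ?_ ?_ ?_ ?_).2
  · exact Eventually.of_forall fun x =>
      (show Continuous _ by fun_prop).aestronglyMeasurable
  · exact (show Continuous _ by fun_prop).intervalIntegrable _ _
  · exact (show Continuous _ by fun_prop).aestronglyMeasurable
  · refine Eventually.of_forall fun τ hτ x hx => hB (x, τ) ⟨ball_subset_closedBall hx, ?_⟩
    rw [uIoc_of_le zero_le_one] at hτ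
    exact Ioc_subset_Icc_self hτ
  · exact intervalIntegrable_const
  · refine Eventually.of_forall fun τ _ x _ => ?_
    have h1 : HasDerivAt (fun x : ℝ => a * x * (1 - τ ^ 2)) (a * (1 - τ ^ 2)) x := by
      simpa using ((hasDerivAt_id x).const_mul a).mul_const (1 - τ ^ 2)
    exact h1.exp.const_mul _

theorem continuous_radialKernelDeriv (d : ℕ) (a : ℝ) : Continuous (radialKernelDeriv d a) :=
  intervalIntegral.continuous_parametric_intervalIntegral_of_continuous'
    (by simp only [Function.uncurry_def]; fun_prop) 0 1

theorem radialKernel_ode {d : ℕ} (hd : 1 ≤ d) (a s : ℝ) :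
    2 * s * radialKernelDeriv d a s = (2 * a * s - d) * radialKernel d a s + 1 := by
  have hderiv : ∀ τ : ℝ, HasDerivAt (fun τ : ℝ => τ ^ d * Real.exp (a * s * (1 - τ ^ 2)))
      (d * (τ ^ (d - 1) * Real.exp (a * s * (1 - τ ^ 2))) - 2 * a * s *
        (τ ^ (d - 1) * Real.exp (a * s * (1 - τ ^ 2))) +
        2 * s * (τ ^ (d - 1) * (Real.exp (a * s * (1 - τ ^ 2)) * (a * (1 - τ ^ 2))))) τ := by
    intro τ
    have h1 : HasDerivAt (fun τ : ℝ => a * s * (1 - τ ^ 2)) (a * s * (-(2 * τ))) τ := by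
      simpa using (((hasDerivAt_pow 2 τ).const_sub 1).const_mul (a * s))
    refine ((hasDerivAt_pow d τ).mul h1.exp).congr_deriv ?_
    obtain ⟨k, rfl⟩ := Nat.exists_eq_add_of_le' hd
    simp only [Nat.add_sub_cancel]
    ring
  have hi : ∀ f : ℝ → ℝ, Continuous f → IntervalIntegrable f volume 0 1 :=
    fun f hf => hf.intervalIntegrable _ _
  have hint := intervalIntegral.integral_eq_sub_of_hasDerivAt (fun τ _ => hderiv τ)
    (hi _ (by fun_prop))
  rw [intervalIntegral.integral_add (hi _ (by fun_prop)) (hi _ (by fun_prop)),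
    intervalIntegral.integral_sub (hi _ (by fun_prop)) (hi _ (by fun_prop)),
    intervalIntegral.integral_const_mul, intervalIntegral.integral_const_mul,
    intervalIntegral.integral_const_mul, ← radialKernel, ← radialKernelDeriv] at hint
  have h0 : (0 : ℝ) ^ d = 0 := zero_pow (by omega)
  simp only [h0, one_pow, sub_self, mul_zero, Real.exp_zero, mul_one, zero_mul, sub_zero] at hint
  linarith

theorem radialKernel_nonneg (d : ℕ) (a s : ℝ) : 0 ≤ radialKernel d a s :=
  intervalIntegral.integral_nonneg zero_le_one fun _ hτ =>
    mul_nonneg (pow_nonneg hτ.1 _) (Real.exp_pos _).le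

theorem radialKernel_le (d : ℕ) {a s : ℝ} (h : 0 ≤ a * s) :
    radialKernel d a s ≤ Real.exp (a * s) := by
  have := intervalIntegral.integral_mono_on (f := fun τ : ℝ =>
    τ ^ (d - 1) * Real.exp (a * s * (1 - τ ^ 2))) (g := fun _ => Real.exp (a * s))
    (μ := volume) zero_le_one
    ((show Continuous _ by fun_prop).intervalIntegrable _ _) intervalIntegrable_const
    fun τ hτ => by
      have h1 : τ ^ (d - 1) ≤ 1 := pow_le_one₀ hτ.1 hτ.2
      have h2 : Real.exp (a * s * (1 - τ ^ 2)) ≤ Real.exp (a * s) :=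
        Real.exp_le_exp.2 (mul_le_of_le_one_right h (by nlinarith [sq_nonneg τ]))
      exact (mul_le_mul h1 h2 (Real.exp_pos _).le zero_le_one).trans_eq (one_mul _)
  simpa [radialKernel] using this

theorem le_radialKernel {d : ℕ} (hd : 1 ≤ d) {a r s : ℝ} (ha : 1 ≤ a) (hs : r ^ 2 ≤ s) :
    Real.exp (-r ^ 2) / d * a ^ (-(d : ℝ) / 2) * Real.exp (a * r ^ 2) ≤ radialKernel d a s := by
  have ha0 : 0 < a := by linarith
  set b : ℝ := (√a)⁻¹ with hb
  have hb0 : 0 < b := by positivity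
  have hb1 : b ≤ 1 := inv_le_one_of_one_le₀ (Real.one_le_sqrt.2 ha)
  have hb2 : a * b ^ 2 = 1 := by
    rw [hb, inv_pow, Real.sq_sqrt ha0.le, mul_inv_cancel₀ ha0.ne']
  have hbd : b ^ d = a ^ (-(d : ℝ) / 2) := by
    rw [hb, Real.sqrt_eq_rpow, ← Real.rpow_neg ha0.le, ← Real.rpow_natCast, ← Real.rpow_mul ha0.le]
    congr 1; ring
  have hc : Continuous fun τ : ℝ => τ ^ (d - 1) * Real.exp (a * s * (1 - τ ^ 2)) := by fun_prop
  have h1 : ∫ τ in (0 : ℝ)..b, τ ^ (d - 1) * Real.exp (a * s * (1 - τ ^ 2)) ≤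
      radialKernel d a s := by
    refine intervalIntegral.integral_mono_interval le_rfl hb0.le hb1 ?_
      (hc.intervalIntegrable _ _)
    refine (ae_restrict_iff' measurableSet_Ioc).2 (Eventually.of_forall fun τ hτ => ?_)
    exact mul_nonneg (pow_nonneg hτ.1.le _) (Real.exp_pos _).le
  refine le_trans ?_ h1
  have h2 : ∫ τ in (0 : ℝ)..b, τ ^ (d - 1) * (Real.exp (-r ^ 2) * Real.exp (a * r ^ 2)) ≤
      ∫ τ in (0 : ℝ)..b, τ ^ (d - 1) * Real.exp (a * s * (1 - τ ^ 2)) := by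
    refine intervalIntegral.integral_mono_on hb0.le
      ((show Continuous _ by fun_prop).intervalIntegrable _ _) (hc.intervalIntegrable _ _)
      fun τ hτ => ?_
    have hτ2 : τ ^ 2 ≤ b ^ 2 := pow_le_pow_left₀ hτ.1 hτ.2 2
    have hτ1 : τ ^ 2 ≤ 1 := hτ2.trans (pow_le_one₀ hb0.le hb1)
    refine mul_le_mul_of_nonneg_left ?_ (pow_nonneg hτ.1 _)
    rw [← Real.exp_add]
    refine Real.exp_le_exp.2 ?_
    have h3 : a * r ^ 2 * (1 - τ ^ 2) ≤ a * s * (1 - τ ^ 2) := by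
      have : 0 ≤ 1 - τ ^ 2 := by linarith
      gcongr
    have h4 : a * τ ^ 2 ≤ 1 := by nlinarith
    nlinarith [mul_le_mul_of_nonneg_left h4 (sq_nonneg r)]
  refine le_trans (le_of_eq ?_) h2
  rw [intervalIntegral.integral_mul_const, integral_pow]
  obtain ⟨k, rfl⟩ := Nat.exists_eq_add_of_le' hd
  rw [← hbd]
  push_cast
  simp
  ring

/-- A bounded radial multiplier `p`, as a function of `s = ‖x‖²`, for which the weighted Laplacian
`-2 s p' + (2 a s - d) p` is at least of order `a` for `s ≥ r²` and exponentially small from below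
elsewhere. -/
theorem exists_radial_profile {d : ℕ} (hd : 1 ≤ d) (r : ℝ) :
    ∃ C : ℝ, 0 < C ∧ ∀ a : ℝ, 1 ≤ a → d ≤ a * r ^ 2 → ∃ p p' : ℝ → ℝ,
      (∀ s, HasDerivAt p (p' s) s) ∧ Continuous p' ∧ (∀ s, 0 ≤ p s ∧ p s ≤ 1) ∧
      (∀ s, 0 ≤ s → -(C * (a ^ ((d : ℝ) / 2) * Real.exp (-a * r ^ 2))) ≤
        -2 * s * p' s + (2 * a * s - d) * p s) ∧
      ∀ s, r ^ 2 ≤ s → a * r ^ 2 / 4 - C * (a ^ ((d : ℝ) / 2) * Real.exp (-a * r ^ 2)) ≤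
        -2 * s * p' s + (2 * a * s - d) * p s := by
  have hd0 : (0 : ℝ) < d := by exact_mod_cast hd
  set A : ℝ := d * Real.exp (r ^ 2) with hA
  have hA0 : 0 < A := by positivity
  refine ⟨A * (1 + d * Real.exp d), by positivity, fun a ha hda => ?_⟩
  have ha0 : 0 < a := by linarith
  set k : ℝ := A * (a ^ ((d : ℝ) / 2) * Real.exp (-a * r ^ 2)) with hk
  have hk0 : 0 < k := by positivity
  have hC : A * (1 + d * Real.exp d) * (a ^ ((d : ℝ) / 2) * Real.exp (-a * r ^ 2)) =
      k + d * (k * Real.exp d) := by rw [hk]; ring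
  rw [hC]
  set K := radialKernel d a
  set K' := radialKernelDeriv d a
  have hK0 : ∀ s, 0 ≤ k * K s := fun s => mul_nonneg hk0.le (radialKernel_nonneg d a s)
  have hpos : ∀ s, 0 < 1 + k * K s := fun s => by linarith [hK0 s]
  have hK1 : ∀ s, r ^ 2 ≤ s → 1 ≤ k * K s := fun s hs => by
    refine le_trans (le_of_eq ?_) (mul_le_mul_of_nonneg_left (le_radialKernel hd ha hs) hk0.le)
    have e1 : Real.exp (r ^ 2) * Real.exp (-r ^ 2) = 1 := by rw [← Real.exp_add]; simp
    have e2 : Real.exp (-a * r ^ 2) * Real.exp (a * r ^ 2) = 1 := by rw [← Real.exp_add]; simp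
    have e3 : a ^ ((d : ℝ) / 2) * a ^ (-(d : ℝ) / 2) = 1 := by
      rw [← Real.rpow_add ha0, show (d : ℝ) / 2 + -(d : ℝ) / 2 = 0 by ring, Real.rpow_zero]
    calc (1 : ℝ) = (Real.exp (r ^ 2) * Real.exp (-r ^ 2)) *
          (Real.exp (-a * r ^ 2) * Real.exp (a * r ^ 2)) *
          (a ^ ((d : ℝ) / 2) * a ^ (-(d : ℝ) / 2)) := by rw [e1, e2, e3]; norm_num
      _ = _ := by rw [hk, hA]; field_simp
  have hKd : ∀ s, HasDerivAt (fun s => k * K s) (k * K' s) s :=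
    fun s => (hasDerivAt_radialKernel d a s).const_mul k
  have hKc : Continuous fun s => k * K s := continuous_iff_continuousAt.2 fun s => (hKd s).continuousAt
  have hode : ∀ s, -2 * s * (k * K' s / (1 + k * K s) ^ 2) +
      (2 * a * s - d) * (k * K s / (1 + k * K s)) =
      -(k / (1 + k * K s) ^ 2) + (2 * a * s - d) * (k * K s / (1 + k * K s)) ^ 2 := fun s => by
    have h1 : 2 * s * K' s = (2 * a * s - d) * K s + 1 := radialKernel_ode hd a s
    have := (hpos s).ne'
    field_simp
    linear_combination (-1 : ℝ) * h1
  have hk1 : ∀ s, k / (1 + k * K s) ^ 2 ≤ k := fun s =>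
    div_le_self hk0.le (one_le_pow₀ (by linarith [hK0 s]))
  have hp0 : ∀ s, 0 ≤ k * K s / (1 + k * K s) := fun s => div_nonneg (hK0 s) (hpos s).le
  have hp1 : ∀ s, k * K s / (1 + k * K s) ≤ 1 := fun s =>
    (div_le_one (hpos s)).2 (by linarith)
  have he0 : 0 ≤ d * (k * Real.exp d) := by positivity
  refine ⟨fun s => k * K s / (1 + k * K s), fun s => k * K' s / (1 + k * K s) ^ 2, fun s => ?_,
    ?_, fun s => ⟨hp0 s, hp1 s⟩, fun s hs => ?_, fun s hs => ?_⟩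
  · refine ((hKd s).div ((hKd s).const_add 1) (hpos s).ne').congr_deriv ?_
    ring
  · exact ((continuous_radialKernelDeriv d a).const_mul k).div
      ((continuous_const.add hKc).pow 2) fun s => (pow_pos (hpos s) 2).ne'
  · rw [hode]
    rcases le_total (d : ℝ) (2 * a * s) with h | h
    · have := mul_nonneg (sub_nonneg.2 h) (sq_nonneg (k * K s / (1 + k * K s)))
      linarith [hk1 s]
    · have has : 0 ≤ a * s := by positivity
      have h1 : (k * K s / (1 + k * K s)) ^ 2 ≤ k * Real.exp d := by
        calc (k * K s / (1 + k * K s)) ^ 2 ≤ k * K s / (1 + k * K s) := by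
              nlinarith [hp0 s, hp1 s]
          _ ≤ k * K s := div_le_self (hK0 s) (by linarith [hK0 s])
          _ ≤ k * Real.exp d := by
              refine mul_le_mul_of_nonneg_left ((radialKernel_le d has).trans ?_) hk0.le
              exact Real.exp_le_exp.2 (by linarith)
      have h2 := mul_le_mul_of_nonneg_left h1 hd0.le
      have h3 : 0 ≤ 2 * a * s * (k * K s / (1 + k * K s)) ^ 2 := by positivity
      nlinarith [hk1 s]
  · rw [hode]
    have h1 : 1 / 2 ≤ k * K s / (1 + k * K s) := by
      rw [div_le_div_iff₀ two_pos (hpos s)]; linarith [hK1 s hs]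
    have h2 : 1 / 4 ≤ (k * K s / (1 + k * K s)) ^ 2 := by nlinarith
    have h3 : a * r ^ 2 ≤ 2 * a * s - d := by nlinarith
    have h4 : a * r ^ 2 * (1 / 4) ≤ (2 * a * s - d) * (k * K s / (1 + k * K s)) ^ 2 :=
      mul_le_mul h3 h2 (by norm_num) (by nlinarith)
    linarith [hk1 s]

theorem norm_gradient_sq_eq_sum {n : ℕ} (w : EuclideanSpace ℝ (Fin n) → ℝ)
    (x : EuclideanSpace ℝ (Fin n)) :
    ‖gradient w x‖ ^ 2 = ∑ i, (fderiv ℝ w x (EuclideanSpace.single i 1)) ^ 2 := by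
  rw [EuclideanSpace.real_norm_sq_eq]
  refine Finset.sum_congr rfl fun i _ => ?_
  have h : inner ℝ (gradient w x) (EuclideanSpace.single i (1 : ℝ)) =
      fderiv ℝ w x (EuclideanSpace.single i 1) := by
    simp [gradient]
  rw [← h, EuclideanSpace.inner_single_right]
  simp

theorem hasLineDerivAt_norm_sq {n : ℕ} (x : EuclideanSpace ℝ (Fin n)) (i : Fin n) :
    HasLineDerivAt ℝ (fun y : EuclideanSpace ℝ (Fin n) => ‖y‖ ^ 2) (2 * x i) x
      (EuclideanSpace.single i 1) := by
  have h := (hasStrictFDerivAt_norm_sq x).hasFDerivAt.hasLineDerivAt (EuclideanSpace.single i 1)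
  have h2 : (2 • innerSL ℝ x) (EuclideanSpace.single i (1 : ℝ)) = 2 * x i := by
    simp [EuclideanSpace.inner_single_right]
  rwa [h2] at h

theorem hasLineDerivAt_coord {n : ℕ} (x : EuclideanSpace ℝ (Fin n)) (i : Fin n) :
    HasLineDerivAt ℝ (fun y : EuclideanSpace ℝ (Fin n) => y i) 1 x
      (EuclideanSpace.single i 1) := by
  simpa [HasLineDerivAt] using (hasDerivAt_id (0 : ℝ)).const_add (x i)

theorem rayleigh_nonneg (n : ℕ) (R μ : ℝ) (w : EuclideanSpace ℝ (Fin n) → ℝ) :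
    0 ≤ rayleigh n R μ w :=
  div_nonneg (integral_nonneg fun x => by positivity) (integral_nonneg fun x => by positivity)

/-- Upper bound for `ν_μ` obtained by testing with a truncated Gaussian. -/
theorem nuBottom_le {d : ℕ} {R r : ℝ} (hr : 0 < r) (hrR : r < R) :
    ∃ C : ℝ, 0 < C ∧ ∀ a : ℝ, 1 ≤ a →
      nuBottom d R a ≤ a * d + C * (a ^ ((d : ℝ) / 2) * Real.exp (-a * r ^ 2)) := by
  have hR : 0 < R := hr.trans hrR
  let χ : ContDiffBump (0 : EuclideanSpace ℝ (Fin d)) := ⟨r, (r + R) / 2, hr, by linarith⟩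
  have hχ : ContDiff ℝ (⊤ : ℕ∞) χ := χ.contDiff
  have hχ1 : ∀ i, Continuous fun x => fderiv ℝ χ x (EuclideanSpace.single i 1) := fun i =>
    (hχ.continuous_fderiv (by simp)).clm_apply continuous_const
  obtain ⟨M, hM⟩ := (isCompact_closedBall (0 : EuclideanSpace ℝ (Fin d)) R).exists_bound_of_continuousOn
    (continuous_finsetSum Finset.univ fun i _ => (hχ1 i).pow 2).continuousOn
  have hM0 : 0 ≤ M := (norm_nonneg _).trans (hM 0 (mem_closedBall_self hR.le))
  set V : ℝ := volume.real (ball (0 : EuclideanSpace ℝ (Fin d)) R) with hV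
  set v : ℝ := volume.real (ball (0 : EuclideanSpace ℝ (Fin d)) r) with hv
  have hv0 : 0 < v := ENNReal.toReal_pos (measure_ball_pos _ _ hr).ne' measure_ball_lt_top.ne
  refine ⟨M * V / (Real.exp (-r ^ 2) * v) + 1, by positivity, fun a ha => ?_⟩
  have ha0 : 0 < a := by linarith
  let g : EuclideanSpace ℝ (Fin d) → ℝ := fun x => Real.exp (-(a / 2) * ‖x‖ ^ 2)
  have hg : ContDiff ℝ (⊤ : ℕ∞) g := (contDiff_const.mul (contDiff_norm_sq ℝ)).exp
  let w : EuclideanSpace ℝ (Fin d) → ℝ := fun x => χ x * g x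
  have hw : ContDiff ℝ (⊤ : ℕ∞) w := hχ.mul hg
  have hw2 : Continuous fun x => w x ^ 2 := hw.continuous.pow 2
  have hwsupp : tsupport w ⊆ closedBall 0 ((r + R) / 2) :=
    (tsupport_mul_subset_left (f := χ) (g := g)).trans χ.tsupport_eq.subset
  have hw0 : ∀ x ∈ sphere (0 : EuclideanSpace ℝ (Fin d)) R, w x = 0 := fun x hx => by
    refine image_eq_zero_of_notMem_tsupport fun h => ?_
    have h1 := hwsupp h
    rw [mem_closedBall_zero_iff] at h1
    rw [mem_sphere_zero_iff_norm] at hx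
    linarith
  have hwline : ∀ x i, fderiv ℝ w x (EuclideanSpace.single i 1) =
      g x * fderiv ℝ χ x (EuclideanSpace.single i 1) - a * x i * w x := fun x i => by
    have h1 : HasLineDerivAt ℝ χ (fderiv ℝ χ x (EuclideanSpace.single i 1)) x
        (EuclideanSpace.single i 1) :=
      ((hχ.differentiable (by simp)) x).hasFDerivAt.hasLineDerivAt _
    have h2 : HasLineDerivAt ℝ w (fderiv ℝ w x (EuclideanSpace.single i 1)) x
        (EuclideanSpace.single i 1) :=
      ((hw.differentiable (by simp)) x).hasFDerivAt.hasLineDerivAt _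
    have h3 := HasDerivAt.mul h1 (HasDerivAt.exp (HasDerivAt.const_mul (-(a / 2))
      (hasLineDerivAt_norm_sq x i)))
    rw [HasDerivAt.unique h2 h3]
    simp only [zero_smul, add_zero, w, g]
    ring
  set D : EuclideanSpace ℝ (Fin d) → ℝ := fun x =>
    ∑ i, fderiv ℝ (fun y : EuclideanSpace ℝ (Fin d) => -(a * (y i * w y ^ 2))) x
      (EuclideanSpace.single i 1) with hD
  have hWc : ∀ i, ContDiff ℝ 1 fun y : EuclideanSpace ℝ (Fin d) => -(a * (y i * w y ^ 2)) := fun i =>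
    (contDiff_const.mul ((contDiff_piLp_apply (p := 2)).mul ((hw.of_le (by simp)).pow 2))).neg
  have hDline : ∀ x i, fderiv ℝ (fun y : EuclideanSpace ℝ (Fin d) => -(a * (y i * w y ^ 2))) x
      (EuclideanSpace.single i 1) = -(a * (w x ^ 2 + x i *
        (2 * w x * fderiv ℝ w x (EuclideanSpace.single i 1)))) := fun x i => by
    have h1 : HasLineDerivAt ℝ w (fderiv ℝ w x (EuclideanSpace.single i 1)) x
        (EuclideanSpace.single i 1) :=
      ((hw.differentiable (by simp)) x).hasFDerivAt.hasLineDerivAt _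
    have h2 := (((hWc i).differentiable one_ne_zero) x).hasFDerivAt.hasLineDerivAt
      (EuclideanSpace.single i 1)
    have h3 := ((HasDerivAt.mul (hasLineDerivAt_coord x i) (HasDerivAt.pow h1 2)).const_mul a).neg
    rw [HasDerivAt.unique h2 h3]
    simp
  obtain ⟨hDint, hD0⟩ := integral_ball_divergence_eq_zero hR (fun i => (hWc i).contDiffOn)
    (fun i x hx => by rw [hw0 x hx]; simp) (fun x _ => (rfl : _ = D x))
  have hpt : ∀ x, ‖gradient w x‖ ^ 2 + a ^ 2 * ‖x‖ ^ 2 * w x ^ 2 =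
      g x ^ 2 * (∑ i, fderiv ℝ χ x (EuclideanSpace.single i 1) ^ 2) + a * d * w x ^ 2 + D x := by
    intro x
    have hd : a * d * w x ^ 2 = ∑ i : Fin d, a * w x ^ 2 := by
      simp; ring
    rw [norm_gradient_sq_eq_sum, EuclideanSpace.real_norm_sq_eq, hD, hd, Finset.mul_sum,
      Finset.mul_sum, Finset.sum_mul, ← Finset.sum_add_distrib, ← Finset.sum_add_distrib,
      ← Finset.sum_add_distrib]
    refine Finset.sum_congr rfl fun i _ => ?_
    rw [hDline, hwline]
    ring
  have hbound : ∀ x ∈ ball (0 : EuclideanSpace ℝ (Fin d)) R,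
      g x ^ 2 * (∑ i, fderiv ℝ χ x (EuclideanSpace.single i 1) ^ 2) ≤
        M * Real.exp (-a * r ^ 2) := by
    intro x hx
    by_cases hxr : x ∈ ball (0 : EuclideanSpace ℝ (Fin d)) r
    · have h1 : fderiv ℝ χ x = 0 := by
        rw [(χ.eventuallyEq_one_of_mem_ball hxr).fderiv_eq]
        exact fderiv_const_apply 1
      simp only [h1, _root_.zero_apply]
      simp
      positivity
    · rw [mem_ball_zero_iff, not_lt] at hxr
      have h1 : g x ^ 2 ≤ Real.exp (-a * r ^ 2) := by
        rw [← Real.exp_nat_mul]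
        refine Real.exp_le_exp.2 ?_
        have : a * r ^ 2 ≤ a * ‖x‖ ^ 2 := by gcongr
        push_cast
        linarith
      have h2 := (Real.le_norm_self _).trans (hM x (ball_subset_closedBall hx))
      rw [mul_comm M]
      exact mul_le_mul h1 h2 (Finset.sum_nonneg fun i _ => sq_nonneg _) (Real.exp_pos _).le
  have hcint : ∀ {F : EuclideanSpace ℝ (Fin d) → ℝ}, Continuous F → IntegrableOn F (ball 0 R) :=
    fun hF => (hF.continuousOn.integrableOn_compact (isCompact_closedBall _ _)).mono_set
      ball_subset_closedBall
  set I : ℝ := ∫ x in ball (0 : EuclideanSpace ℝ (Fin d)) R, w x ^ 2 with hI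
  have hnum : ∫ x in ball (0 : EuclideanSpace ℝ (Fin d)) R,
      (‖gradient w x‖ ^ 2 + a ^ 2 * ‖x‖ ^ 2 * w x ^ 2) ≤
      M * Real.exp (-a * r ^ 2) * V + a * d * I := by
    have hc1 : IntegrableOn (fun x => g x ^ 2 *
        (∑ i, fderiv ℝ χ x (EuclideanSpace.single i 1) ^ 2)) (ball 0 R) :=
      hcint ((hg.continuous.pow 2).mul (continuous_finsetSum _ fun i _ => (hχ1 i).pow 2))
    have hc2 : IntegrableOn (fun x => a * d * w x ^ 2) (ball 0 R) := hcint (hw2.const_mul _)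
    have hc0 : IntegrableOn (fun _ : EuclideanSpace ℝ (Fin d) => M * Real.exp (-a * r ^ 2))
      (ball 0 R) := hcint continuous_const
    have hc12 : IntegrableOn (fun x => g x ^ 2 *
        (∑ i, fderiv ℝ χ x (EuclideanSpace.single i 1) ^ 2) + a * d * w x ^ 2) (ball 0 R) :=
      hc1.add hc2
    simp only [hpt]
    rw [integral_add hc12 hDint, hD0, add_zero, integral_add hc1 hc2, integral_const_mul]
    have := setIntegral_mono_on hc1 hc0 measurableSet_ball hbound
    rw [setIntegral_const, smul_eq_mul, mul_comm] at this
    linarith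
  have hIlow : Real.exp (-r ^ 2) * v * a ^ (-((d : ℝ) / 2)) ≤ I := by
    set b : ℝ := (√a)⁻¹ with hb
    have hb0 : 0 < b := by positivity
    have hb1 : b ≤ 1 := inv_le_one_of_one_le₀ (Real.one_le_sqrt.2 ha)
    have hb2 : a * b ^ 2 = 1 := by
      rw [hb, inv_pow, Real.sq_sqrt ha0.le, mul_inv_cancel₀ ha0.ne']
    have hbd : b ^ d = a ^ (-((d : ℝ) / 2)) := by
      rw [hb, Real.sqrt_eq_rpow, ← Real.rpow_neg ha0.le, ← Real.rpow_natCast,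
        ← Real.rpow_mul ha0.le]
      congr 1; ring
    have hbr : b * r ≤ r := mul_le_of_le_one_left hr.le hb1
    have hsub : ball (0 : EuclideanSpace ℝ (Fin d)) (b * r) ⊆ ball 0 R :=
      ball_subset_ball (hbr.trans hrR.le)
    have h1 : ∫ x in ball (0 : EuclideanSpace ℝ (Fin d)) (b * r), Real.exp (-r ^ 2) ≤
        ∫ x in ball (0 : EuclideanSpace ℝ (Fin d)) (b * r), w x ^ 2 := by
      refine setIntegral_mono_on ((hcint continuous_const).mono_set hsub)
        ((hcint hw2).mono_set hsub) measurableSet_ball fun x hx => ?_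
      rw [mem_ball_zero_iff] at hx
      have hx1 : χ x = 1 := χ.one_of_mem_closedBall (by
        rw [mem_closedBall_zero_iff]; exact hx.le.trans hbr)
      simp only [w, g, hx1, one_mul]
      rw [← Real.exp_nat_mul]
      refine Real.exp_le_exp.2 ?_
      have h2 : a * ‖x‖ ^ 2 ≤ a * (b * r) ^ 2 := by gcongr
      have h3 : a * (b * r) ^ 2 = r ^ 2 := by rw [mul_pow, ← mul_assoc, hb2, one_mul]
      push_cast
      linarith
    have h2 : ∫ x in ball (0 : EuclideanSpace ℝ (Fin d)) (b * r), w x ^ 2 ≤ I :=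
      setIntegral_mono_set (hcint hw2) (Eventually.of_forall fun x => sq_nonneg _)
        (LE.le.eventuallyLE hsub)
    have h3 : volume.real (ball (0 : EuclideanSpace ℝ (Fin d)) (b * r)) = b ^ d * v := by
      rw [hv, measureReal_def, measureReal_def, Measure.addHaar_ball_mul_of_pos _ _ hb0,
        ENNReal.toReal_mul, ENNReal.toReal_ofReal (by positivity), finrank_euclideanSpace_fin]
    rw [setIntegral_const, h3, hbd, smul_eq_mul] at h1
    linarith
  have hp : 0 < a ^ (-((d : ℝ) / 2)) := Real.rpow_pos_of_pos ha0 _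
  have hIpos : 0 < I := lt_of_lt_of_le (by positivity) hIlow
  have hray : rayleigh d R a w ≤
      a * d + M * V / (Real.exp (-r ^ 2) * v) * (a ^ ((d : ℝ) / 2) * Real.exp (-a * r ^ 2)) := by
    rw [rayleigh, ← hI]
    calc _ ≤ (M * Real.exp (-a * r ^ 2) * V + a * d * I) / I := by gcongr
      _ = a * d + M * Real.exp (-a * r ^ 2) * V / I := by field_simp; ring
      _ ≤ a * d + M * Real.exp (-a * r ^ 2) * V /
          (Real.exp (-r ^ 2) * v * a ^ (-((d : ℝ) / 2))) := by gcongr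
      _ = _ := by
        rw [Real.rpow_neg ha0.le]
        field_simp
  have hle : nuBottom d R a ≤ rayleigh d R a w := by
    refine csInf_le ⟨0, ?_⟩ ⟨w, hw, ?_, ?_, ?_, rfl⟩
    · rintro _ ⟨f, -, -, -, -, rfl⟩
      exact rayleigh_nonneg d R a f
    · exact HasCompactSupport.intro (isCompact_closedBall 0 ((r + R) / 2)) fun x hx =>
        image_eq_zero_of_notMem_tsupport fun h => hx (hwsupp h)
    · exact hwsupp.trans (closedBall_subset_ball (by linarith))
    · intro h
      rw [hI, h] at hIpos
      simp at hIpos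
  refine hle.trans (hray.trans ?_)
  gcongr
  linarith

/-- Weighted `L²` estimate obtained by testing the eigenvalue equation for `u` against
`u * φ(‖x‖²)`, where `φ' = p`. -/
theorem mul_integral_sq_le {d : ℕ} {R a ν C T m r : ℝ} (hR : 0 < R) (hr : 0 ≤ r)
    {p p' : ℝ → ℝ} (hp : ∀ s, HasDerivAt p (p' s) s) (hp' : Continuous p')
    (hp01 : ∀ s, 0 ≤ p s ∧ p s ≤ 1)
    (hlow : ∀ s, 0 ≤ s → -C ≤ -2 * s * p' s + (2 * a * s - d) * p s)
    (hlow' : ∀ s, r ^ 2 ≤ s → m - C ≤ -2 * s * p' s + (2 * a * s - d) * p s)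
    (hT : 0 ≤ T) (hν : ν ≤ a * d + T)
    {u : EuclideanSpace ℝ (Fin d) → ℝ} (hu : ContDiffOn ℝ (⊤ : ℕ∞) u (closedBall 0 R))
    (hu0 : ∀ x ∈ sphere (0 : EuclideanSpace ℝ (Fin d)) R, u x = 0)
    (hu1 : ∫ x in ball (0 : EuclideanSpace ℝ (Fin d)) R, u x ^ 2 = 1)
    (heq : ∀ x ∈ ball (0 : EuclideanSpace ℝ (Fin d)) R,
      -lapl u x + a ^ 2 * ‖x‖ ^ 2 * u x = ν * u x) :
    m * ∫ x in {x : EuclideanSpace ℝ (Fin d) | x ∈ ball (0 : EuclideanSpace ℝ (Fin d)) R ∧ r < ‖x‖},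
      u x ^ 2 ≤ C + T * R ^ 2 := by
  have hpc : Continuous p := continuous_iff_continuousAt.2 fun s => (hp s).continuousAt
  have hpC : ContDiff ℝ 1 p := contDiff_one_iff_deriv.2
    ⟨fun s => (hp s).differentiableAt, by rwa [show deriv p = p' from funext fun s => (hp s).deriv]⟩
  set f : ℝ → ℝ := fun s => ∫ t in (0 : ℝ)..s, p t with hf
  have hfd : ∀ s, HasDerivAt f (p s) s := fun s =>
    intervalIntegral.integral_hasDerivAt_right (hpc.intervalIntegrable _ _)
      hpc.stronglyMeasurable.stronglyMeasurableAtFilter hpc.continuousAt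
  have hfC : ContDiff ℝ 1 f := contDiff_one_iff_deriv.2
    ⟨fun s => (hfd s).differentiableAt, by
      rwa [show deriv f = p from funext fun s => (hfd s).deriv]⟩
  have hf0 : ∀ s, 0 ≤ s → 0 ≤ f s := fun s hs =>
    intervalIntegral.integral_nonneg hs fun t _ => (hp01 t).1
  have hf1 : ∀ s, 0 ≤ s → f s ≤ s := fun s hs => by
    have := intervalIntegral.integral_mono_on (g := fun _ => (1 : ℝ)) (μ := volume) hs
      (hpc.intervalIntegrable 0 s) intervalIntegrable_const fun t _ => (hp01 t).2
    simpa using this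
  let e : Fin d → EuclideanSpace ℝ (Fin d) := fun i => EuclideanSpace.single i 1
  let G : Fin d → EuclideanSpace ℝ (Fin d) → ℝ := fun i x =>
    fderivWithin ℝ u (closedBall 0 R) x (e i)
  have huC : ContDiffOn ℝ 1 u (closedBall 0 R) := hu.of_le (by simp)
  have hGC : ∀ i, ContDiffOn ℝ 1 (G i) (closedBall 0 R) := fun i =>
    (hu.fderivWithin (uniqueDiffOn_closedBall hR)
      (WithTop.coe_le_coe.2 le_top : ((1 + 1 : ℕ∞) : WithTop ℕ∞) ≤ _)).clm_apply contDiffOn_const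
  have hnhds : ∀ x ∈ ball (0 : EuclideanSpace ℝ (Fin d)) R, closedBall 0 R ∈ nhds x :=
    fun x hx => mem_of_superset (isOpen_ball.mem_nhds hx) ball_subset_closedBall
  have hGu : ∀ i, ∀ x ∈ ball (0 : EuclideanSpace ℝ (Fin d)) R, G i x = fderiv ℝ u x (e i) :=
    fun i x hx => by simp only [G, fderivWithin_of_mem_nhds (hnhds x hx)]
  let W : Fin d → EuclideanSpace ℝ (Fin d) → ℝ := fun i x =>
    u x * (f (‖x‖ ^ 2) * G i x + a * (x i * (f (‖x‖ ^ 2) * u x)) - u x * (p (‖x‖ ^ 2) * x i))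
  have hns : ContDiff ℝ 1 fun x : EuclideanSpace ℝ (Fin d) => ‖x‖ ^ 2 := contDiff_norm_sq ℝ
  have hxi : ∀ i, ContDiff ℝ 1 fun x : EuclideanSpace ℝ (Fin d) => x i :=
    fun i => contDiff_piLp_apply (p := 2)
  have hWC : ∀ i, ContDiffOn ℝ 1 (W i) (closedBall 0 R) := fun i =>
    huC.mul ((((hfC.comp hns).contDiffOn.mul (hGC i)).add (contDiffOn_const.mul
      ((hxi i).contDiffOn.mul ((hfC.comp hns).contDiffOn.mul huC)))).sub
      (huC.mul ((hpC.comp hns).mul (hxi i)).contDiffOn))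
  let D : EuclideanSpace ℝ (Fin d) → ℝ := fun x =>
    f (‖x‖ ^ 2) * (∑ i, (G i x + a * x i * u x) ^ 2) + (a * d - ν) * f (‖x‖ ^ 2) * u x ^ 2 +
      (-2 * ‖x‖ ^ 2 * p' (‖x‖ ^ 2) + (2 * a * ‖x‖ ^ 2 - d) * p (‖x‖ ^ 2)) * u x ^ 2
  have hWline : ∀ i, ∀ x ∈ ball (0 : EuclideanSpace ℝ (Fin d)) R, fderiv ℝ (W i) x (e i) =
      f (‖x‖ ^ 2) * (G i x + a * x i * u x) ^ 2 + f (‖x‖ ^ 2) * u x * fderiv ℝ (G i) x (e i)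
        + (2 * a * p (‖x‖ ^ 2) * u x ^ 2 - 2 * p' (‖x‖ ^ 2) * u x ^ 2
            - f (‖x‖ ^ 2) * a ^ 2 * u x ^ 2) * x i ^ 2
        + (a * f (‖x‖ ^ 2) - p (‖x‖ ^ 2)) * u x ^ 2 := by
    intro i x hx
    have hline : ∀ {F : EuclideanSpace ℝ (Fin d) → ℝ}, ContDiffOn ℝ 1 F (closedBall 0 R) →
        HasLineDerivAt ℝ F (fderiv ℝ F x (e i)) x (e i) := fun hF =>
      ((hF.contDiffAt (hnhds x hx)).differentiableAt one_ne_zero).hasFDerivAt.hasLineDerivAt _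
    have h1 : HasDerivAt (fun t : ℝ => u (x + t • e i)) (G i x) 0 := by
      rw [hGu i x hx]; exact hline huC
    have h2 : HasDerivAt (fun t : ℝ => G i (x + t • e i)) (fderiv ℝ (G i) x (e i)) 0 :=
      hline (hGC i)
    have h3 : HasDerivAt (fun t : ℝ => ‖x + t • e i‖ ^ 2) (2 * x i) 0 := hasLineDerivAt_norm_sq x i
    have h4 : HasDerivAt (fun t : ℝ => (x + t • e i) i) 1 0 := hasLineDerivAt_coord x i
    have h5 : HasDerivAt (fun t : ℝ => f (‖x + t • e i‖ ^ 2)) (p (‖x‖ ^ 2) * (2 * x i)) 0 :=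
      HasDerivAt.comp (h₂ := f) 0 (by simpa using hfd (‖x‖ ^ 2)) h3
    have h6 : HasDerivAt (fun t : ℝ => p (‖x + t • e i‖ ^ 2)) (p' (‖x‖ ^ 2) * (2 * x i)) 0 :=
      HasDerivAt.comp (h₂ := p) 0 (by simpa using hp (‖x‖ ^ 2)) h3
    have h7 := h1.mul (((h5.mul h2).add ((h4.mul (h5.mul h1)).const_mul a)).sub
      (h1.mul (h6.mul h4)))
    have h8 : HasDerivAt (fun t : ℝ => W i (x + t • e i)) (fderiv ℝ (W i) x (e i)) 0 :=
      hline (hWC i)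
    rw [h8.unique h7]
    simp only [Pi.mul_apply, Pi.add_apply, Pi.sub_apply, zero_smul, add_zero]
    ring
  have hDsum : ∀ x ∈ ball (0 : EuclideanSpace ℝ (Fin d)) R,
      ∑ i, fderiv ℝ (W i) x (EuclideanSpace.single i 1) = D x := by
    intro x hx
    have hlap : ∑ i, fderiv ℝ (G i) x (e i) = a ^ 2 * ‖x‖ ^ 2 * u x - ν * u x := by
      have h1 : ∑ i, fderiv ℝ (G i) x (e i) = lapl u x := by
        refine Finset.sum_congr rfl fun i _ => ?_
        rw [Filter.EventuallyEq.fderiv_eq (f := fun z => fderiv ℝ u z (e i))]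
        filter_upwards [isOpen_ball.mem_nhds hx] with z hz using hGu i z hz
      rw [h1]
      linarith [heq x hx]
    have hsq := EuclideanSpace.real_norm_sq_eq x
    rw [Finset.sum_congr rfl fun i _ => hWline i x hx, Finset.sum_add_distrib,
      Finset.sum_add_distrib, Finset.sum_add_distrib, ← Finset.mul_sum, ← Finset.mul_sum,
      ← Finset.mul_sum, hlap, ← hsq]
    simp only [Finset.sum_const, Finset.card_univ, Fintype.card_fin, nsmul_eq_mul, D]
    ring
  obtain ⟨hDint, hD0⟩ := integral_ball_divergence_eq_zero hR hWC
    (fun i x hx => by simp only [W, hu0 x hx, zero_mul]) hDsum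
  have hu2 : IntegrableOn (fun x => u x ^ 2) (ball 0 R) :=
    ((hu.continuousOn.pow 2).integrableOn_compact (isCompact_closedBall _ _)).mono_set
      ball_subset_closedBall
  have hA : MeasurableSet {x : EuclideanSpace ℝ (Fin d) | r < ‖x‖} :=
    (isOpen_lt continuous_const continuous_norm).measurableSet
  have hmu : IntegrableOn (fun x => m * u x ^ 2) (ball 0 R) := hu2.const_mul m
  have hmA : IntegrableOn ({x : EuclideanSpace ℝ (Fin d) | r < ‖x‖}.indicator fun x => m * u x ^ 2)
    (ball 0 R) := hmu.indicator hA
  have hCu : IntegrableOn (fun x => (C + T * R ^ 2) * u x ^ 2) (ball 0 R) := hu2.const_mul _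
  have hmono := setIntegral_mono_on (hmA.sub hCu) hDint measurableSet_ball fun x hx => by
    have hxR : ‖x‖ ^ 2 ≤ R ^ 2 := by
      rw [mem_ball_zero_iff] at hx
      gcongr
    have hx0 : (0 : ℝ) ≤ ‖x‖ ^ 2 := sq_nonneg _
    have h1 : 0 ≤ f (‖x‖ ^ 2) * (∑ i, (G i x + a * x i * u x) ^ 2) :=
      mul_nonneg (hf0 _ hx0) (Finset.sum_nonneg fun i _ => sq_nonneg _)
    have h2 : -(T * R ^ 2) ≤ (a * d - ν) * f (‖x‖ ^ 2) := by
      have h3 : f (‖x‖ ^ 2) ≤ R ^ 2 := (hf1 _ hx0).trans hxR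
      nlinarith [mul_le_mul_of_nonneg_left h3 hT,
        mul_le_mul_of_nonneg_right (show -T ≤ a * d - ν by linarith) (hf0 _ hx0)]
    have h4 := mul_le_mul_of_nonneg_right h2 (sq_nonneg (u x))
    by_cases hxA : x ∈ {x : EuclideanSpace ℝ (Fin d) | r < ‖x‖}
    · have h5 := mul_le_mul_of_nonneg_right
        (hlow' (‖x‖ ^ 2) (pow_le_pow_left₀ hr (le_of_lt hxA) 2)) (sq_nonneg (u x))
      simp only [Pi.sub_apply, indicator_of_mem hxA, D]
      linarith
    · have h5 := mul_le_mul_of_nonneg_right (hlow (‖x‖ ^ 2) hx0) (sq_nonneg (u x))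
      simp only [Pi.sub_apply, indicator_of_notMem hxA, D]
      linarith
  simp only [Pi.sub_apply] at hmono
  rw [hD0, integral_sub hmA hCu, setIntegral_indicator hA, integral_const_mul, integral_const_mul,
    hu1, mul_one] at hmono
  exact sub_nonpos.1 hmono

/-- Concentration of the ground state: for `0 < r < R` and
`A = {x ∈ B_R : ‖x‖ > r}`, there is `c > 0` such that for every `μ ≥ 1`, every smooth
nonnegative `L²`-normalized first Dirichlet eigenfunction `ϖ` of `−Δ + μ²‖x‖²` on `B_R`
satisfies `∫_A ϖ² ≤ c (μ^{d/2−1} e^{−μr²} + μ^{2+d/2} e^{−μR²})`. -/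
theorem statement18 (d : ℕ) (hd : 1 ≤ d) (R r : ℝ) (hr : 0 < r) (hrR : r < R) :
    ∃ c : ℝ, 0 < c ∧
      ∀ μ : ℝ, 1 ≤ μ →
      ∀ ϖ : EuclideanSpace ℝ (Fin d) → ℝ,
        ContDiffOn ℝ (⊤ : ℕ∞) ϖ (closedBall (0 : EuclideanSpace ℝ (Fin d)) R) →
        (∀ x ∈ closedBall (0 : EuclideanSpace ℝ (Fin d)) R, 0 ≤ ϖ x) →
        (∀ x ∈ sphere (0 : EuclideanSpace ℝ (Fin d)) R, ϖ x = 0) →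
        (∫ x in ball (0 : EuclideanSpace ℝ (Fin d)) R, (ϖ x) ^ 2) = 1 →
        (∀ x ∈ ball (0 : EuclideanSpace ℝ (Fin d)) R,
          -lapl ϖ x + μ ^ 2 * ‖x‖ ^ 2 * ϖ x = nuBottom d R μ * ϖ x) →
        (∫ x in {x : EuclideanSpace ℝ (Fin d) | x ∈ ball (0 : EuclideanSpace ℝ (Fin d)) R ∧ r < ‖x‖},
            (ϖ x) ^ 2) ≤
          c * (μ ^ ((d : ℝ) / 2 - 1) * Real.exp (-μ * r ^ 2)
            + μ ^ (2 + (d : ℝ) / 2) * Real.exp (-μ * R ^ 2)) := by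
  have hR : 0 < R := hr.trans hrR
  have hd0 : (0 : ℝ) < d := by exact_mod_cast hd
  obtain ⟨C₁, hC₁, hprof⟩ := exists_radial_profile hd r
  obtain ⟨C₂, hC₂, hnu⟩ := nuBottom_le (d := d) hr hrR
  refine ⟨4 / r ^ 2 * (C₁ + C₂ * R ^ 2) + d / r ^ 2 * Real.exp d, by positivity,
    fun μ hμ ϖ hsm _ hbd hnorm heq => ?_⟩
  have hμ0 : 0 < μ := by linarith
  set T : ℝ := μ ^ ((d : ℝ) / 2 - 1) * Real.exp (-μ * r ^ 2) with hT
  have hT0 : 0 < T := by positivity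
  set I : ℝ := ∫ x in {x : EuclideanSpace ℝ (Fin d) |
    x ∈ ball (0 : EuclideanSpace ℝ (Fin d)) R ∧ r < ‖x‖}, ϖ x ^ 2
  suffices h : I ≤ (4 / r ^ 2 * (C₁ + C₂ * R ^ 2) + d / r ^ 2 * Real.exp d) * T by
    refine h.trans ?_
    gcongr
    exact le_add_of_nonneg_right (by positivity)
  have hμT : μ ^ ((d : ℝ) / 2) * Real.exp (-μ * r ^ 2) = μ * T := by
    rw [hT, ← mul_assoc, ← Real.rpow_one_add' hμ0.le (by ring_nf; positivity)]
    ring_nf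
  rcases le_total (d : ℝ) (μ * r ^ 2) with hlarge | hsmall
  · obtain ⟨p, p', hp, hp', hp01, hlow, hlow'⟩ := hprof μ hμ hlarge
    have key := mul_integral_sq_le hR hr.le hp hp' hp01 hlow hlow' (by positivity)
      (hnu μ hμ) hsm hbd hnorm heq
    rw [hμT] at key
    have h1 : I ≤ 4 / r ^ 2 * (C₁ + C₂ * R ^ 2) * T := by
      have h2 : μ * r ^ 2 / 4 * I ≤ μ * r ^ 2 / 4 * (4 / r ^ 2 * (C₁ + C₂ * R ^ 2) * T) := by
        refine key.trans (le_of_eq ?_)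
        field_simp
      exact le_of_mul_le_mul_left h2 (by positivity)
    have h3 : 0 ≤ d / r ^ 2 * Real.exp d * T := by positivity
    linarith
  · have hI1 : I ≤ 1 := by
      rw [← hnorm]
      refine setIntegral_mono_set ?_ (Eventually.of_forall fun x => sq_nonneg _)
        (LE.le.eventuallyLE fun x hx => hx.1)
      exact ((hsm.continuousOn.pow 2).integrableOn_compact (isCompact_closedBall _ _)).mono_set
        ball_subset_closedBall
    have h1 : r ^ 2 / d ≤ μ ^ ((d : ℝ) / 2 - 1) := by
      calc r ^ 2 / d ≤ μ⁻¹ := by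
            rw [div_le_iff₀ hd0, inv_mul_eq_div, le_div_iff₀ hμ0]
            linarith
        _ = μ ^ (-1 : ℝ) := (Real.rpow_neg_one μ).symm
        _ ≤ _ := Real.rpow_le_rpow_of_exponent_le hμ (by linarith)
    have h2 : Real.exp (-d) ≤ Real.exp (-μ * r ^ 2) := Real.exp_le_exp.2 (by linarith)
    have h3 : r ^ 2 / d * Real.exp (-d) ≤ T := mul_le_mul h1 h2 (Real.exp_pos _).le (by positivity)
    have h4 : 1 ≤ d / r ^ 2 * Real.exp d * T := by
      refine le_trans (le_of_eq ?_) (mul_le_mul_of_nonneg_left h3 (by positivity))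
      rw [Real.exp_neg]
      field_simp
    have h5 : 0 ≤ 4 / r ^ 2 * (C₁ + C₂ * R ^ 2) * T := by positivity
    linarith
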